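/- Let A₁,A₂,A₃,B₁,B₂,B₃,C ∈ ℝ² with A₁+B₁ = A₂+B₂ = A₃+B₃ satisfy condition (⋆). Then there exist a,b > 0 with C = aA₁ + bB₁; and for any such a,b, defining A_j^t := tA_j + (1−t)aA₁ and B_j^t := tB_j + (1−t)bB₁ for t ∈ [0,1] and j = 1,2,3, one has A₁^t+B₁^t = A₂^t+B₂^t = A₃^t+B₃^t for every t ∈ [0,1], and the vectors A₁^t,A₂^t,A₃^t,B₁^t,B₂^t,B₃^t,C satisfy condition (⋆) for every t ∈ [0,1]. -/

import Mathlib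

open scoped BigOperators

/-- The cone spanned by two vectors in `ℝ²`. -/
def cone2 (u v : ℝ × ℝ) : Set (ℝ × ℝ) :=
  {x | ∃ a b : ℝ, 0 ≤ a ∧ 0 ≤ b ∧ x = a • u + b • v}

/-- Condition (⋆). -/
def starCond (A B : Fin 3 → ℝ × ℝ) (C : ℝ × ℝ) : Prop :=
  (∀ i j : Fin 3, C ∉ cone2 (A i) (A j)) ∧
  (∀ i j : Fin 3, C ∉ cone2 (B i) (B j)) ∧
  (∀ i j : Fin 3, C ∈ cone2 (A i) (B j))

/-- The determinant of the matrix with columns `u` and `v`. -/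
def planeDet (u v : ℝ × ℝ) : ℝ := u.1 * v.2 - u.2 * v.1

lemma planeDet_combo_left (a b : ℝ) (u v w : ℝ × ℝ) :
    planeDet (a • u + b • v) w = a * planeDet u w + b * planeDet v w := by
  simp only [planeDet, Prod.fst_add, Prod.snd_add, Prod.smul_fst, Prod.smul_snd, smul_eq_mul]
  ring

lemma planeDet_combo_right (a b : ℝ) (w u v : ℝ × ℝ) :
    planeDet w (a • u + b • v) = a * planeDet w u + b * planeDet w v := by
  simp only [planeDet, Prod.fst_add, Prod.snd_add, Prod.smul_fst, Prod.smul_snd, smul_eq_mul]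
  ring

lemma planeDet_self (u : ℝ × ℝ) : planeDet u u = 0 := by
  simp only [planeDet]
  ring

lemma planeDet_swap (u v : ℝ × ℝ) : planeDet v u = -planeDet u v := by
  simp only [planeDet]
  ring

lemma smul_mem_cone2_self {c : ℝ} (hc : 0 ≤ c) (u : ℝ × ℝ) : c • u ∈ cone2 u u :=
  ⟨c, 0, hc, le_rfl, by simp⟩

lemma exists_eq_smul_of_planeDet_eq_zero {u v : ℝ × ℝ} (hu : u ≠ 0) (h : planeDet u v = 0) :
    ∃ c : ℝ, v = c • u := by
  have hpos : u.1 ^ 2 + u.2 ^ 2 ≠ 0 := by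
    intro h0
    apply hu
    ext
    · exact pow_eq_zero_iff two_ne_zero |>.mp (by nlinarith [sq_nonneg u.1, sq_nonneg u.2])
    · exact pow_eq_zero_iff two_ne_zero |>.mp (by nlinarith [sq_nonneg u.1, sq_nonneg u.2])
  unfold planeDet at h
  refine ⟨(u.1 * v.1 + u.2 * v.2) / (u.1 ^ 2 + u.2 ^ 2), ?_⟩
  ext
  · simp only [Prod.smul_fst, smul_eq_mul]
    field_simp
    linear_combination -u.2 * h
  · simp only [Prod.smul_snd, smul_eq_mul]
    field_simp
    linear_combination u.1 * h

lemma exists_pos_combo_of_mem_cone2 {u v C : ℝ × ℝ} (hu : C ∉ cone2 u u) (hv : C ∉ cone2 v v)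
    (h : C ∈ cone2 u v) : ∃ a b : ℝ, 0 < a ∧ 0 < b ∧ C = a • u + b • v := by
  obtain ⟨a, b, ha, hb, rfl⟩ := h
  refine ⟨a, b, ha.lt_of_ne ?_, hb.lt_of_ne ?_, rfl⟩
  · rintro rfl
    exact hv (by simpa using smul_mem_cone2_self hb v)
  · rintro rfl
    exact hu (by simpa using smul_mem_cone2_self ha u)

lemma planeDet_ne_zero_of_mem_cone2 {u v C : ℝ × ℝ} (hu : C ∉ cone2 u u) (hv : C ∉ cone2 v v)
    (h : C ∈ cone2 u v) : planeDet u v ≠ 0 := by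
  intro h0
  obtain ⟨a, b, ha, hb, rfl⟩ := exists_pos_combo_of_mem_cone2 hu hv h
  by_cases hu0 : u = 0
  · subst hu0
    exact hv (by simpa using smul_mem_cone2_self hb.le v)
  obtain ⟨c, rfl⟩ := exists_eq_smul_of_planeDet_eq_zero hu0 h0
  rcases le_or_gt 0 c with hc | hc
  · refine hu ?_
    rw [smul_smul, ← add_smul]
    exact smul_mem_cone2_self (by positivity) u
  rcases le_or_gt 0 (a + b * c) with hs | hs
  · refine hu ?_
    rw [smul_smul, ← add_smul]
    exact smul_mem_cone2_self hs u
  · refine hv ?_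
    have key : a • u + b • c • u = ((a + b * c) / c) • c • u := by
      rw [smul_smul, smul_smul, ← add_smul, div_mul_cancel₀ _ hc.ne]
    rw [key]
    exact smul_mem_cone2_self (div_nonneg_of_nonpos hs.le hc.le) (c • u)

lemma planeDet_signs_of_mem_cone2 {u v C : ℝ × ℝ} (hu : C ∉ cone2 u u) (hv : C ∉ cone2 v v)
    (h : C ∈ cone2 u v) :
    planeDet C u * planeDet C v < 0 ∧ planeDet C u * planeDet u v < 0 := by
  have h0 := planeDet_ne_zero_of_mem_cone2 hu hv h
  obtain ⟨a, b, ha, hb, rfl⟩ := exists_pos_combo_of_mem_cone2 hu hv h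
  simp only [planeDet_combo_left, planeDet_self, planeDet_swap u v]
  have hsq : 0 < planeDet u v ^ 2 := by positivity
  constructor
  · nlinarith [mul_pos (mul_pos ha hb) hsq]
  · nlinarith [mul_pos hb hsq]

lemma notMem_cone2_of_planeDet_pos {s : ℝ} {u v C : ℝ × ℝ} (hC : C ≠ 0)
    (hu : 0 < s * planeDet C u) (hv : 0 < s * planeDet C v) : C ∉ cone2 u v := by
  rintro ⟨a, b, ha, hb, h⟩
  have hsum : a * (s * planeDet C u) + b * (s * planeDet C v) = 0 := by
    have h' := planeDet_combo_right a b C u v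
    rw [← h, planeDet_self] at h'
    linear_combination -s * h'
  have ha0 : a = 0 := by nlinarith [mul_nonneg ha hu.le, mul_nonneg hb hv.le]
  have hb0 : b = 0 := by nlinarith [mul_nonneg ha hu.le, mul_nonneg hb hv.le]
  exact hC (by simp [h, ha0, hb0])

lemma mem_cone2_of_planeDet_signs {s : ℝ} {u v C : ℝ × ℝ} (hu : 0 < s * planeDet C u)
    (hv : s * planeDet C v < 0) (huv : s * planeDet u v < 0) : C ∈ cone2 u v := by
  have hs : s ≠ 0 := left_ne_zero_of_mul huv.ne
  have hD : planeDet u v ≠ 0 := right_ne_zero_of_mul huv.ne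
  refine ⟨s * planeDet C v / (s * planeDet u v), -(s * planeDet C u) / (s * planeDet u v),
    div_nonneg_of_nonpos hv.le huv.le,
    div_nonneg_of_nonpos (neg_nonpos.mpr hu.le) huv.le, ?_⟩
  rw [← mul_neg, mul_div_mul_left _ _ hs, mul_div_mul_left _ _ hs]
  ext
  · simp only [Prod.fst_add, Prod.smul_fst, smul_eq_mul]
    field_simp
    simp only [planeDet]
    ring
  · simp only [Prod.snd_add, Prod.smul_snd, smul_eq_mul]
    field_simp
    simp only [planeDet]
    ring

/-- Condition (⋆) says that, up to orientation, the `A i` lie strictly on one side of the line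
through `C`, the `B j` strictly on the other, and each pair `A i`, `B j` spans an angle less than
`π` around `C`. -/
lemma starCond_iff_planeDet_signs {A B : Fin 3 → ℝ × ℝ} {C : ℝ × ℝ} :
    starCond A B C ↔ ∃ s : ℝ, (∀ i, 0 < s * planeDet C (A i)) ∧
      (∀ j, s * planeDet C (B j) < 0) ∧ ∀ i j, s * planeDet (A i) (B j) < 0 := by
  constructor
  · rintro ⟨hA, hB, hAB⟩
    have h i j := planeDet_signs_of_mem_cone2 (hA i i) (hB j j) (hAB i j)
    have hpos i : 0 < planeDet C (A 0) * planeDet C (A i) := by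
      have := mul_pos_of_neg_of_neg (h 0 0).1 (h i 0).1
      refine pos_of_mul_pos_left (b := planeDet C (B 0) ^ 2) ?_ (sq_nonneg _)
      linarith
    refine ⟨planeDet C (A 0), hpos, fun j => (h 0 j).1, fun i j => ?_⟩
    have := mul_neg_of_pos_of_neg (hpos i) (h i j).2
    refine neg_of_mul_neg_left (b := planeDet C (A i) ^ 2) ?_ (sq_nonneg _)
    linarith
  · rintro ⟨s, hA, hB, hAB⟩
    have hC : C ≠ 0 := by
      rintro rfl
      simpa [planeDet] using hA 0
    refine ⟨fun i j => notMem_cone2_of_planeDet_pos hC (hA i) (hA j),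
      fun i j => notMem_cone2_of_planeDet_pos (s := -s) hC ?_ ?_,
      fun i j => mem_cone2_of_planeDet_signs (hA i) (hB j) (hAB i j)⟩
    · linarith [hB i]
    · linarith [hB j]

lemma convex_combo_pos {t x y : ℝ} (ht : t ∈ Set.Icc (0 : ℝ) 1) (hx : 0 < x) (hy : 0 < y) :
    0 < t * x + (1 - t) * y :=
  (convex_Ioi (0 : ℝ)) hx hy ht.1 (sub_nonneg.mpr ht.2) (by ring)

lemma starCond_convex_combo {A B : Fin 3 → ℝ × ℝ} {C : ℝ × ℝ} (h : starCond A B C)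
    (k l : Fin 3) {a b t : ℝ} (ha : 0 < a) (hb : 0 < b) (ht : t ∈ Set.Icc (0 : ℝ) 1) :
    starCond (fun j => t • A j + (1 - t) • (a • A k))
      (fun j => t • B j + (1 - t) • (b • B l)) C := by
  obtain ⟨s, hA, hB, hAB⟩ := starCond_iff_planeDet_signs.mp h
  refine starCond_iff_planeDet_signs.mpr ⟨s, fun i => ?_, fun j => ?_, fun i j => ?_⟩
  · have := convex_combo_pos ht (hA i) (mul_pos ha (hA k))
    simp only [smul_smul, planeDet_combo_right]
    linarith
  · have := convex_combo_pos ht (neg_pos.mpr (hB j)) (mul_pos hb (neg_pos.mpr (hB l)))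
    simp only [smul_smul, planeDet_combo_right]
    linarith
  · have h₁ := convex_combo_pos ht (neg_pos.mpr (hAB i j)) (mul_pos hb (neg_pos.mpr (hAB i l)))
    have h₂ := convex_combo_pos ht (neg_pos.mpr (hAB k j)) (mul_pos hb (neg_pos.mpr (hAB k l)))
    have := convex_combo_pos ht h₁ (mul_pos ha h₂)
    simp only [smul_smul, planeDet_combo_right, planeDet_combo_left]
    linarith

theorem stmt10 (A B : Fin 3 → ℝ × ℝ) (C : ℝ × ℝ)
    (hsum : A 0 + B 0 = A 1 + B 1 ∧ A 1 + B 1 = A 2 + B 2)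
    (hstar : starCond A B C) :
    (∃ a b : ℝ, 0 < a ∧ 0 < b ∧ C = a • A 0 + b • B 0) ∧
    (∀ a b : ℝ, 0 < a → 0 < b → C = a • A 0 + b • B 0 →
      ∀ t ∈ Set.Icc (0 : ℝ) 1,
        ((t • A 0 + (1 - t) • (a • A 0)) + (t • B 0 + (1 - t) • (b • B 0)) =
            (t • A 1 + (1 - t) • (a • A 0)) + (t • B 1 + (1 - t) • (b • B 0)) ∧
          (t • A 1 + (1 - t) • (a • A 0)) + (t • B 1 + (1 - t) • (b • B 0)) =
            (t • A 2 + (1 - t) • (a • A 0)) + (t • B 2 + (1 - t) • (b • B 0))) ∧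
        starCond (fun j => t • A j + (1 - t) • (a • A 0))
          (fun j => t • B j + (1 - t) • (b • B 0)) C) := by
  have hconst (i j : Fin 3) (h : A i + B i = A j + B j) (t : ℝ) (u v : ℝ × ℝ) :
      (t • A i + u) + (t • B i + v) = (t • A j + u) + (t • B j + v) := by
    rw [add_add_add_comm, ← smul_add, h, smul_add, add_add_add_comm]
  refine ⟨exists_pos_combo_of_mem_cone2 (hstar.1 0 0) (hstar.2.1 0 0) (hstar.2.2 0 0), ?_⟩
  intro a b ha hb _ t ht
  exact ⟨⟨hconst 0 1 hsum.1 t _ _, hconst 1 2 hsum.2 t _ _⟩,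
    starCond_convex_combo hstar 0 0 ha hb ht⟩
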